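/- arXiv:2505.14430 — 2 statements merged into one kernel-verified Lean document; each statement's English description precedes it below -/
import Mathlib

section
/- Let H be a real Hilbert space, p, λ ∈ H, η > 0 and τ > 0, and set s := p − η•λ. Then the soft-thresholding fixed-point equation (‖s‖⁻¹ · max(‖s‖ − τη, 0)) • s = p holds if and only if ⟪λ, p⟫ = −τ‖p‖ and ‖λ‖ ≤ τ. (Here the scalar coefficient is interpreted as 0 when s = 0, by the convention 0⁻¹ = 0 in ℝ.) -/
open RealInnerProductSpace

/-- Equality case of Cauchy–Schwarz on the ball of radius `τ`. -/
lemma eq_neg_smul_of_inner_eq_neg_mul_norm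
    {H : Type*} [NormedAddCommGroup H] [InnerProductSpace ℝ H] {p lam : H} {τ : ℝ}
    (hp : p ≠ 0) (h : ⟪lam, p⟫ = -(τ * ‖p‖)) (hle : ‖lam‖ ≤ τ) :
    lam = -(τ / ‖p‖) • p := by
  have hp' : 0 < ‖p‖ := norm_pos_iff.mpr hp
  have hsq : ‖lam + (τ / ‖p‖) • p‖ ^ 2 = ‖lam‖ ^ 2 - τ ^ 2 := by
    rw [norm_add_sq_real, inner_smul_right, h, norm_smul, mul_pow, Real.norm_eq_abs, sq_abs]
    field_simp
    ring
  have hnorm : ‖lam + (τ / ‖p‖) • p‖ ^ 2 = 0 :=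
    le_antisymm (by rw [hsq]; nlinarith [norm_nonneg lam]) (sq_nonneg _)
  rw [neg_smul]
  exact eq_neg_of_add_eq_zero_left (norm_eq_zero.mp (pow_eq_zero_iff two_ne_zero |>.mp hnorm))

/-- With `s := p − η•λ`, the soft-thresholding fixed-point equation
`(‖s‖⁻¹·max(‖s‖ − τη, 0)) • s = p` holds iff `⟪λ, p⟫ = −τ‖p‖` and `‖λ‖ ≤ τ`. -/
theorem soft_threshold_fixed_point_iff_dual
    {H : Type*} [NormedAddCommGroup H] [InnerProductSpace ℝ H] [CompleteSpace H]
    (p lam : H) (η τ : ℝ) (hη : 0 < η) (hτ : 0 < τ) :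
    ((‖p - η • lam‖⁻¹ * max (‖p - η • lam‖ - τ * η) 0) • (p - η • lam) = p) ↔
      (⟪lam, p⟫ = -(τ * ‖p‖) ∧ ‖lam‖ ≤ τ) := by
  constructor
  · intro h
    obtain ⟨s, hs⟩ : ∃ s, s = p - η • lam := ⟨_, rfl⟩
    rw [← hs] at h
    rcases le_or_gt ‖s‖ (τ * η) with hle | hlt
    · obtain rfl : p = 0 := by
        rw [← h, max_eq_right (by linarith), mul_zero, zero_smul]
      rw [hs, zero_sub, norm_neg, norm_smul, Real.norm_of_nonneg hη.le, mul_comm] at hle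
      exact ⟨by simp, le_of_mul_le_mul_right hle hη⟩
    · have hpos : 0 < ‖s‖ := (mul_pos hτ hη).trans hlt
      rw [max_eq_left (by linarith)] at h
      have hlam : lam = -(τ / ‖s‖) • s := by
        have hsmul : η • lam = η • (-(τ / ‖s‖) • s) := by
          rw [show η • lam = p - s by rw [hs]; abel, ← h, smul_smul]
          refine (by module : _ = (‖s‖⁻¹ * (‖s‖ - τ * η) - 1) • s).trans ?_
          congr 1
          field_simp
          ring
        exact smul_right_injective H hη.ne' hsmul
      have hnp : ‖p‖ = ‖s‖ - τ * η := by
        rw [← h, norm_smul, Real.norm_of_nonneg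
          (mul_nonneg (inv_nonneg.mpr hpos.le) (by linarith))]
        field_simp
      constructor
      · rw [hnp, ← h, hlam, inner_smul_left, inner_smul_right, real_inner_self_eq_norm_sq,
          conj_trivial]
        field_simp
      · rw [hlam, norm_smul, norm_neg, Real.norm_of_nonneg (by positivity)]
        exact (div_mul_cancel₀ τ hpos.ne').le
  · rintro ⟨h, hle⟩
    by_cases hp : p = 0
    · subst hp
      have hns : ‖(0 : H) - η • lam‖ ≤ τ * η := by
        rw [zero_sub, norm_neg, norm_smul, Real.norm_of_nonneg hη.le, mul_comm]
        exact mul_le_mul_of_nonneg_right hle hη.le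
      rw [max_eq_right (by linarith), mul_zero, zero_smul]
    · have hp' : 0 < ‖p‖ := norm_pos_iff.mpr hp
      have hs : p - η • lam = (1 + η * τ / ‖p‖) • p := by
        rw [eq_neg_smul_of_inner_eq_neg_mul_norm hp h hle]
        module
      have hns : ‖p - η • lam‖ = ‖p‖ + τ * η := by
        rw [hs, norm_smul, Real.norm_of_nonneg (by positivity)]
        field_simp
      rw [hns, add_sub_cancel_right, max_eq_left hp'.le, hs, smul_smul]
      have hpos : 0 < ‖p‖ + τ * η := by positivity
      convert one_smul ℝ p using 2
      field_simp
end

section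
/- Let H be a real Hilbert space, p, λ ∈ H, η > 0 and τ > 0, and set s := p − η•λ. If the soft-thresholding fixed-point equation (‖s‖⁻¹ · max(‖s‖ − τη, 0)) • s = p holds and p ≠ 0, then λ = −(τ‖p‖⁻¹) • p, i.e. λ = −τ p/‖p‖. -/
open RealInnerProductSpace

/-- A nonzero value `p` of soft thresholding at level `t` determines the thresholded vector. -/
theorem eq_add_smul_of_soft_threshold_eq {E : Type*} [NormedAddCommGroup E] [NormedSpace ℝ E]
    {s p : E} {t : ℝ} (h : (‖s‖⁻¹ * max (‖s‖ - t) 0) • s = p) (hp : p ≠ 0) :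
    s = p + (t * ‖p‖⁻¹) • p := by
  have hs : s ≠ 0 := by
    rintro rfl
    exact hp (by simpa using h.symm)
  have hn : 0 < ‖s‖ := norm_pos_iff.mpr hs
  have ht : 0 < ‖s‖ - t := by
    by_contra! hle
    exact hp (by simpa [max_eq_right hle] using h.symm)
  rw [max_eq_left ht.le] at h
  have hpn : ‖p‖ = ‖s‖ - t := by
    rw [← h, norm_smul, Real.norm_of_nonneg (by positivity)]
    field_simp
  rw [hpn, ← h, smul_smul, ← add_smul]
  have hc : ‖s‖⁻¹ * (‖s‖ - t) + t * (‖s‖ - t)⁻¹ * (‖s‖⁻¹ * (‖s‖ - t)) = 1 := by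
    field_simp [ht.ne']
    ring
  rw [hc, one_smul]

/-- With `s := p − η•λ`, if the soft-thresholding fixed-point equation
`(‖s‖⁻¹·max(‖s‖ − τη, 0)) • s = p` holds and `p ≠ 0`, then `λ = −τ p/‖p‖`. -/
theorem soft_threshold_fixed_point_lambda_eq
    {H : Type*} [NormedAddCommGroup H] [InnerProductSpace ℝ H] [CompleteSpace H]
    (p lam : H) (η τ : ℝ) (hη : 0 < η) (hτ : 0 < τ)
    (heq : (‖p - η • lam‖⁻¹ * max (‖p - η • lam‖ - τ * η) 0) • (p - η • lam) = p)
    (hp : p ≠ 0) :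
    lam = -((τ * ‖p‖⁻¹) • p) := by
  have h := eq_add_smul_of_soft_threshold_eq heq hp
  rw [sub_eq_add_neg, add_right_inj] at h
  refine smul_right_injective H hη.ne' ?_
  change η • lam = η • -((τ * ‖p‖⁻¹) • p)
  rw [neg_eq_iff_eq_neg.mp h, smul_neg, smul_smul]
  congr 2
  ring
end
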